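/- If γ₁, γ₂, …, γ_l are 3-terms of (O₆, ℤ×O₆) having the same degree n that are simultaneously f-connected and g-connected, then η(π(γ₁ + γ₂ + ⋯ + γ_l)) = 0 in ℤ/3ℤ. -/

import Mathlib

namespace QHom

variable {X S : Type*}

/-- Generating tuples: an element of `S` together with a list of quandle elements
whose consecutive entries are distinct. -/
abbrev Gen (X S : Type*) := {p : S × List X // p.2.Chain' (· ≠ ·)}

/-- The chain group: the free abelian group on `Gen X S`. -/
abbrev Ch (X S : Type*) := Gen X S →₀ ℤ

/-- The basis chain associated to a tuple; `0` if two consecutive entries coincide. -/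
noncomputable def gen (s : S) (l : List X) : Ch X S := by
  classical
  exact if h : l.Chain' (· ≠ ·) then Finsupp.single ⟨(s, l), h⟩ 1 else 0

noncomputable def fOn (t : Gen X S) : Ch X S :=
  ∑ j : Fin t.1.2.length, ((-1 : ℤ) ^ ((j : ℕ) + 1)) • gen t.1.1 (t.1.2.eraseIdx (j : ℕ))

/-- The map `f`. -/
noncomputable def fmap (γ : Ch X S) : Ch X S := γ.sum fun t c => c • fOn t

noncomputable def gOn (op : X → X → X) (sact : S → X → S) (t : Gen X S) : Ch X S :=
  ∑ j : Fin t.1.2.length,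
    ((-1 : ℤ) ^ (j : ℕ)) •
      gen (sact t.1.1 (t.1.2.get j))
        ((t.1.2.take (j : ℕ)).map (fun x => op x (t.1.2.get j)) ++ t.1.2.drop ((j : ℕ) + 1))

/-- The map `g`. -/
noncomputable def gmap (op : X → X → X) (sact : S → X → S) (γ : Ch X S) : Ch X S :=
  γ.sum fun t c => c • gOn op sact t

/-- The boundary map `∂ = f + g`. -/
noncomputable def bd (op : X → X → X) (sact : S → X → S) (γ : Ch X S) : Ch X S :=
  fmap γ + gmap op sact γ

/-- `γ` is an `m`-chain: it is supported on tuples of length `m`. -/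
def IsMChain (m : ℕ) (γ : Ch X S) : Prop := ∀ t ∈ γ.support, t.1.2.length = m

/-- The length of a chain: the sum of the absolute values of its coefficients. -/
noncomputable def chainLen (γ : Ch X S) : ℕ := γ.sum fun _ c => c.natAbs

/-- `π` : forget the `S`-coordinate. -/
noncomputable def proj (γ : Ch X S) : Ch X Unit := γ.sum fun t c => c • gen () t.1.2

/-- Evaluation of a cochain (given by its values on generating tuples) on a chain. -/
noncomputable def evalCh {A : Type*} [AddCommGroup A] (θ : List X → A) (δ : Ch X Unit) : A :=
  δ.sum fun t c => c • θ t.1.2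

/-- The action of quandle generators on the `X`-set `ℤ × X`. -/
def zact (op : X → X → X) (s : ℤ × X) (a : X) : ℤ × X := (s.1 + 1, op s.2 a)

/-- `γ` is a 3-term of degree `n` and index `u`. -/
def IsTerm3 (γ : Ch X (ℤ × X)) (n : ℤ) (u : X) : Prop :=
  ∃ ε a b c, (ε = (1 : ℤ) ∨ ε = -1) ∧ a ≠ b ∧ b ≠ c ∧ γ = ε • gen (n, u) [a, b, c]

def Efficient {k : ℕ} (γ : Fin k → Ch X S) : Prop := ∀ i j, i ≠ j → γ i ≠ -γ j

def FConnected {k : ℕ} (γ : Fin k → Ch X S) : Prop :=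
  Efficient γ ∧ (∑ i, fmap (γ i)) = 0 ∧
    ∀ I : Finset (Fin k), I.Nonempty → I ≠ Finset.univ → (∑ i ∈ I, fmap (γ i)) ≠ 0

def GConnected {k : ℕ} (op : X → X → X) (sact : S → X → S) (γ : Fin k → Ch X S) : Prop :=
  Efficient γ ∧ (∑ i, gmap op sact (γ i)) = 0 ∧
    ∀ I : Finset (Fin k), I.Nonempty → I ≠ Finset.univ → (∑ i ∈ I, gmap op sact (γ i)) ≠ 0

/-- `n` is the minimal degree of `γ`. -/
def MinDegree (γ : Ch X (ℤ × X)) (n : ℤ) : Prop :=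
  (∃ t ∈ γ.support, t.1.1.1 = n) ∧ ∀ t ∈ γ.support, n ≤ t.1.1.1

/-- `|T_k(γ)|`: the number of terms (with multiplicity) of `γ` of degree `k`. -/
noncomputable def Tcount (γ : Ch X (ℤ × X)) (k : ℤ) : ℕ :=
  γ.sum fun t c => if t.1.1.1 = k then c.natAbs else 0

def revList (op : X → X → X) : List X → List X
  | [] => []
  | a :: l => l.foldl op a :: revList op l

/-- The reverse of a chain of `(X, ℤ × X)` (a chain of the dual quandle). -/
noncomputable def reverse (op : X → X → X) (γ : Ch X (ℤ × X)) : Ch X (ℤ × X) :=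
  γ.sum fun t c => c • gen (-t.1.1.1, t.1.2.foldl op t.1.1.2) (revList op t.1.2)

/-- The degree-shift automorphism `σ`. -/
noncomputable def sigmaMap (γ : Ch X (ℤ × X)) : Ch X (ℤ × X) :=
  γ.sum fun t c => c • gen (t.1.1.1 + 1, t.1.1.2) t.1.2

/-- `γ` is a 3-term of type `ty` with respect to the operation `op`. -/
def IsTypedTerm (op : X → X → X) (γ : Ch X (ℤ × X)) (ty : ℕ) : Prop :=
  ∃ (ε n : ℤ) (u a b c : X), (ε = 1 ∨ ε = -1) ∧ a ≠ b ∧ b ≠ c ∧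
    γ = ε • gen (n, u) [a, b, c] ∧
    ((ty = 0 ∧ a = c ∧ op a b = c) ∨ (ty = 1 ∧ a = c ∧ op a b ≠ c) ∨
      (ty = 2 ∧ a ≠ c ∧ op a b = c) ∨ (ty = 3 ∧ a ≠ c ∧ op a b ≠ c))

/-- A bigon 3-term `⟨x, y⟩` of degree `n` and index `u`. -/
def IsBigon (n : ℤ) (u x y : X) (δ : Ch X (ℤ × X)) : Prop :=
  δ = gen (n, u) [x, y, x] ∨ δ = gen (n, u) [y, x, y]

/-- The case shapes (A), (B), (C). -/
def Shape (δ : Ch X (ℤ × X)) (n : ℤ) (l : ℕ) : Prop :=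
  (4 ≤ l ∧ l ≤ 7 ∧ Tcount δ n = l) ∨
  (6 ≤ l ∧ l ≤ 7 ∧ Tcount δ n = 2 ∧ Tcount δ (n + 1) = l - 2) ∨
  (6 ≤ l ∧ l ≤ 7 ∧ Tcount δ n = 3 ∧ Tcount δ (n + 1) = l - 3)

/-- A quandle structure on `X`. -/
structure QuandleStr (X : Type*) where
  op : X → X → X
  idem : ∀ a, op a a = a
  bij : ∀ b, Function.Bijective fun a => op a b
  dist : ∀ a b c, op (op a b) c = op (op a c) (op b c)

/-- The dual quandle operation. -/
noncomputable def dualOp (Q : QuandleStr X) : X → X → X :=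
  fun a b => (Equiv.ofBijective (fun x => Q.op x b) (Q.bij b)).symm a

/-- An `X`-set: a set with a right action of the associated group `G(X)`, recorded via its
action of the generators, which is bijective generator-wise and compatible with the
defining relations of `G(X)`. -/
structure QSet (X : Type*) (op : X → X → X) (S : Type*) where
  sact : S → X → S
  bij : ∀ a, Function.Bijective fun s => sact s a
  comm : ∀ s a b, sact (sact s a) b = sact (sact s b) (op a b)

/-- The 7-dihedral quandle operation on `ZMod 7`. -/
def R7op : ZMod 7 → ZMod 7 → ZMod 7 := fun a b => 2 * b - a

def zetaInt (a b c : ℤ) : ℤ := (a - b) * ((b ^ 7 + (2 * c - b) ^ 7 - 2 * c ^ 7) / 7)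

/-- The Mochizuki 3-cocycle on triples. -/
def zetaFun (a b c : ZMod 7) : ZMod 7 := (zetaInt a.val b.val c.val : ℤ)

def zetaL : List (ZMod 7) → ZMod 7
  | [a, b, c] => zetaFun a b c
  | _ => 0

/-- The octahedral quandle operation on `Fin 6`: `octAct a b = σ_b(a)`. -/
def octAct : Fin 6 → Fin 6 → Fin 6 := fun a b =>
  ![![0, 2, 4, 3, 5, 1],
    ![5, 1, 0, 2, 4, 3],
    ![1, 3, 2, 4, 0, 5],
    ![0, 5, 1, 3, 2, 4],
    ![2, 1, 3, 5, 4, 0],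
    ![4, 0, 2, 1, 3, 5]] b a

/-- `σ₀`, the rotation about the axis through `0` and `3`. -/
def sig0 : Fin 6 → Fin 6 := fun a => octAct a 0

def etaTriples1 : List (Fin 6 × Fin 6 × Fin 6) :=
  [(0, 1, 2), (0, 3, 1), (1, 2, 0), (1, 4, 2), (3, 1, 5)]

def etaTriples2 : List (Fin 6 × Fin 6 × Fin 6) :=
  [(0, 1, 5), (1, 0, 1), (1, 0, 5), (1, 2, 1), (1, 3, 1), (1, 3, 2), (1, 4, 5), (1, 5, 1),
    (3, 0, 1), (3, 1, 0), (3, 1, 2)]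

/-- The 3-cocycle `η` of the octahedral quandle, on triples. -/
noncomputable def etaFun (a b c : Fin 6) : ZMod 3 := by
  classical
  exact
    if ∃ k : ℕ, ∃ p ∈ etaTriples1, a = sig0^[k] p.1 ∧ b = sig0^[k] p.2.1 ∧ c = sig0^[k] p.2.2
      then 1
    else if ∃ k : ℕ, ∃ p ∈ etaTriples2, a = sig0^[k] p.1 ∧ b = sig0^[k] p.2.1 ∧ c = sig0^[k] p.2.2
      then 2
    else 0

noncomputable def etaL : List (Fin 6) → ZMod 3
  | [a, b, c] => etaFun a b c
  | _ => 0

theorem gen_of_isChain (s : S) {l : List X} (h : l.IsChain (· ≠ ·)) :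
    gen s l = Finsupp.single ⟨(s, l), h⟩ 1 :=
  dif_pos h

theorem gen_of_not_isChain (s : S) {l : List X} (h : ¬ l.IsChain (· ≠ ·)) :
    (gen s l : Ch X S) = 0 :=
  dif_neg h

/-- The linear extension of a cochain, given by its values on generating tuples. -/
noncomputable def extend {A : Type*} [AddCommGroup A] (θ : S → List X → A) : Ch X S →ₗ[ℤ] A :=
  Finsupp.linearCombination ℤ fun t => θ t.1.1 t.1.2

theorem extend_gen {A : Type*} [AddCommGroup A] (θ : S → List X → A) (s : S) {l : List X}
    (h : l.IsChain (· ≠ ·)) : extend θ (gen s l) = θ s l := by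
  simp [extend, gen_of_isChain s h]

theorem evalCh_proj {A : Type*} [AddCommGroup A] (θ : List X → A) (δ : Ch X S) :
    evalCh θ (proj δ) = extend (fun _ => θ) δ := by
  have h : evalCh θ (proj δ) = extend (fun _ => θ)
      (Finsupp.linearCombination ℤ (fun t : Gen X S => gen () t.1.2) δ) := rfl
  rw [h, Finsupp.linearCombination_apply, map_finsuppSum]
  refine Finsupp.sum_congr fun t _ => ?_
  rw [map_smul]
  exact congrArg _ (extend_gen (fun _ : Unit => θ) () t.2)

theorem extend_gen_pair {A : Type*} [AddCommGroup A] (θ : S → List X → A) (s : S)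
    (hθ : ∀ x, θ s [x, x] = 0) (x y : X) : extend θ (gen s [x, y]) = θ s [x, y] := by
  by_cases h : x = y
  · subst h
    rw [gen_of_not_isChain s (by simp), map_zero, hθ]
  · exact extend_gen θ s (List.isChain_pair.2 h)

theorem gen_apply_ne_zero {s : S} {l : List X} {t : Gen X S} (h : gen s l t ≠ 0) :
    t.1 = (s, l) := by
  classical
  by_cases hl : l.IsChain (· ≠ ·)
  · by_contra hne
    refine h ?_
    rw [gen_of_isChain s hl, Finsupp.single_apply, if_neg]
    rintro rfl
    exact hne rfl
  · simp [gen_of_not_isChain s hl] at h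

theorem sum_smul_gen {A : Type*} [AddCommGroup A] (F : Gen X S → A) (ε : ℤ) (s : S) {l : List X}
    (h : l.IsChain (· ≠ ·)) :
    ((ε • gen s l : Ch X S).sum fun t c => c • F t) = ε • F ⟨(s, l), h⟩ := by
  rw [gen_of_isChain s h, Finsupp.smul_single, Finsupp.sum_single_index] <;> simp

theorem chain_triple {a b c : X} (hab : a ≠ b) (hbc : b ≠ c) :
    [a, b, c].IsChain (· ≠ ·) := by
  simp [hab, hbc]

theorem fmap_triple (ε : ℤ) (s : S) {a b c : X} (hab : a ≠ b) (hbc : b ≠ c) :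
    fmap (ε • gen s [a, b, c]) =
      ε • (-gen s [b, c] + gen s [a, c] - gen s [a, b]) := by
  rw [fmap, sum_smul_gen _ _ _ (chain_triple hab hbc)]
  simp [fOn, Fin.sum_univ_succ, List.eraseIdx, sub_eq_add_neg, add_assoc]

theorem gmap_triple (op : X → X → X) (sact : S → X → S) (ε : ℤ) (s : S) {a b c : X}
    (hab : a ≠ b) (hbc : b ≠ c) :
    gmap op sact (ε • gen s [a, b, c]) =
      ε • (gen (sact s a) [b, c] - gen (sact s b) [op a b, c]
        + gen (sact s c) [op a c, op b c]) := by
  rw [gmap, sum_smul_gen _ _ _ (chain_triple hab hbc)]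
  simp [gOn, Fin.sum_univ_succ, sub_eq_add_neg, add_assoc]

/-- In a minimal vanishing sum of finitely supported functions, any labelling of the base points
that is constant on the support of each summand takes the same value on all of them. -/
theorem label_eq_of_minimal_sum_eq_zero {ι T κ M : Type*} [Fintype ι] [AddCommMonoid M]
    (v : ι → T →₀ M) (label : T → κ) (χ : ι → κ)
    (hlabel : ∀ i t, v i t ≠ 0 → label t = χ i) (hsum : ∑ i, v i = 0)
    (hmin : ∀ I : Finset ι, I.Nonempty → I ≠ Finset.univ → ∑ i ∈ I, v i ≠ 0) (i j : ι) :
    χ i = χ j := by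
  classical
  by_contra hij
  refine hmin {k | χ k = χ j} ⟨j, by simp⟩ (fun h => hij ?_) ?_
  · simpa using h.ge (Finset.mem_univ i)
  ext t
  rw [Finsupp.finsetSum_apply, Finsupp.zero_apply]
  by_cases ht : label t = χ j
  · have := DFunLike.congr_fun hsum t
    rw [Finsupp.finsetSum_apply, Finsupp.zero_apply] at this
    rw [← this]
    refine Finset.sum_subset (Finset.subset_univ _) fun k _ hk => ?_
    by_contra hne
    exact hk (by simp [← hlabel k t hne, ht])
  · refine Finset.sum_eq_zero fun k hk => ?_
    by_contra hne
    exact ht ((hlabel k t hne).trans (by simpa using hk))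

theorem octAct_dist (a b c : Fin 6) :
    octAct (octAct a b) c = octAct (octAct a c) (octAct b c) := by
  revert a b c
  decide

theorem sig0_iterate_four : sig0^[4] = id := by
  funext a
  revert a
  decide

theorem exists_sig0_iterate_iff (L : List (Fin 6 × Fin 6 × Fin 6)) (a b c : Fin 6) :
    (∃ k : ℕ, ∃ p ∈ L, a = sig0^[k] p.1 ∧ b = sig0^[k] p.2.1 ∧ c = sig0^[k] p.2.2) ↔
      ∃ k : Fin 4, ∃ p ∈ L, a = sig0^[k] p.1 ∧ b = sig0^[k] p.2.1 ∧ c = sig0^[k] p.2.2 := by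
  refine ⟨fun ⟨k, h⟩ => ⟨⟨k % 4, Nat.mod_lt _ (by norm_num)⟩, ?_⟩, fun ⟨k, h⟩ => ⟨k, h⟩⟩
  have hk : sig0^[k % 4] = sig0^[k] := by
    conv_rhs => rw [← Nat.mod_add_div k 4, Function.iterate_add, Function.iterate_mul,
      sig0_iterate_four, Function.iterate_id, Function.comp_id]
  simpa only [hk] using h

/-- The digit of `N` in base `3` at the position indexed by the pair `(x, y)`. -/
def trit (N : ℕ) (x y : Fin 6) : ZMod 3 := ((N / 3 ^ (6 * (x : ℕ) + y) % 3 : ℕ) : ZMod 3)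

/-- Base-`3` encodings of the cochains `φ u w` of `eta_eq_coboundary`. -/
def phiCode : Fin 6 → Fin 6 → ℕ :=
  ![![1853051742420876, 31470349809, 156949407900, 68724563774472, 721793108598, 3487172472],
    ![617673442521015, 31381092510, 68630377371780, 285945044949, 191802371796, 5212742863365],
    ![68631568862169, 83881658454795, 226727139081, 5902243848788535, 94315602240, 345191676111],
    ![68724563774472, 721793108598, 3487172472, 1853051742420876, 31470349809, 156949407900],
    ![285945044949, 191802371796, 5212742863365, 617673442521015, 31381092510, 68630377371780],
    ![5902243848788535, 94315602240, 345191676111, 68631568862169, 83881658454795, 226727139081]]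

/-- Base-`3` encodings of the cochains `ψ u w` of `eta_eq_coboundary`. -/
def psiCode : Fin 6 → Fin 6 → ℕ :=
  ![![1858951338317235, 205894618879065, 31381060437, 0, 6794407374181398, 2740641294],
    ![205953894391014, 13123719004019259, 0, 15254711515071, 137543184648243, 7016615523],
    ![189864738936, 7632571053789, 1250605434732543, 153111762710154, 847417749606, 5970842946598959],
    ![0, 6794407374181398, 2740641294, 1858951338317235, 205894618879065, 31381060437],
    ![15254711515071, 137543184648243, 7016615523, 205953894391014, 13123719004019259, 0],
    ![153111762710154, 847417749606, 5970842946598959, 189864738936, 7632571053789, 1250605434732543]]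

/-- A `2`-cochain read off from the base-`3` digits of `N`. -/
def tritL (N : ℕ) : List (Fin 6) → ZMod 3
  | [x, y] => trit N x y
  | _ => 0

theorem trit_code_self (u w x : Fin 6) :
    trit (phiCode u w) x x = 0 ∧ trit (psiCode u w) x x = 0 := by
  revert u w x
  decide +kernel

/-- On the `3`-terms starting at index `u` and ending at index `w`, the cocycle `η` is the sum of
the pullback of a cochain along `f` and the pullback of a cochain along `g`. -/
theorem eta_eq_coboundary {a b c : Fin 6} (hab : a ≠ b) (hbc : b ≠ c) (u w : Fin 6)
    (hw : octAct (octAct (octAct u a) b) c = w) :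
    etaFun a b c =
      (-trit (phiCode u w) b c + trit (phiCode u w) a c - trit (phiCode u w) a b) +
      (trit (psiCode u w) b c - trit (psiCode u w) (octAct a b) c +
        trit (psiCode u w) (octAct a c) (octAct b c)) := by
  subst hw
  have h : ∀ u a b c : Fin 6, a ≠ b → b ≠ c →
      (if ∃ k : Fin 4, ∃ p ∈ etaTriples1, a = sig0^[k] p.1 ∧ b = sig0^[k] p.2.1 ∧ c = sig0^[k] p.2.2
        then (1 : ZMod 3)
      else if ∃ k : Fin 4, ∃ p ∈ etaTriples2,
          a = sig0^[k] p.1 ∧ b = sig0^[k] p.2.1 ∧ c = sig0^[k] p.2.2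
        then 2 else 0) =
      let w := octAct (octAct (octAct u a) b) c
      (-trit (phiCode u w) b c + trit (phiCode u w) a c - trit (phiCode u w) a b) +
      (trit (psiCode u w) b c - trit (psiCode u w) (octAct a b) c +
        trit (psiCode u w) (octAct a c) (octAct b c)) := by
    decide +kernel
  rw [← h u a b c hab hbc, etaFun]
  simp only [exists_sig0_iterate_iff]

/-- simultaneously `f`- and `g`-connected 3-terms of `(O₆, ℤ × O₆)` of a
common degree have total `η`-weight zero. -/
theorem fg_connected_O6_eta_zero (n : ℤ) (l : ℕ) (hl : 0 < l)
    (γ : Fin l → Ch (Fin 6) (ℤ × Fin 6)) (hterm : ∀ i, ∃ u, IsTerm3 (γ i) n u)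
    (hf : FConnected γ) (hg : GConnected octAct (zact octAct) γ) :
    evalCh etaL (proj (∑ i, γ i)) = 0 := by
  choose u ε a b c _ hab hbc hγ using hterm
  obtain ⟨-, hfsum, hfmin⟩ := hf
  obtain ⟨-, hgsum, hgmin⟩ := hg
  have hfγ i := hγ i ▸ fmap_triple (ε i) (n, u i) (hab i) (hbc i)
  have hgγ i := hγ i ▸ gmap_triple octAct (zact octAct) (ε i) (n, u i) (hab i) (hbc i)
  have hu := label_eq_of_minimal_sum_eq_zero (fun i => fmap (γ i)) (fun t => t.1.1.2) u
    (by
      intro i t ht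
      contrapose! ht
      have h0 (m : List (Fin 6)) : gen (n, u i) m t = 0 := by
        by_contra h
        exact ht (by simp [gen_apply_ne_zero h])
      simp [hfγ, h0]) hfsum hfmin
  have hw := label_eq_of_minimal_sum_eq_zero (fun i => gmap octAct (zact octAct) (γ i))
    (fun t => t.1.2.foldl octAct t.1.1.2)
    (fun i => octAct (octAct (octAct (u i) (a i)) (b i)) (c i))
    (by
      intro i t ht
      contrapose! ht
      have h0 (s : ℤ × Fin 6) (m : List (Fin 6))
          (h : m.foldl octAct s.2 = octAct (octAct (octAct (u i) (a i)) (b i)) (c i)) :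
          gen s m t = 0 := by
        by_contra hne
        exact ht (by simp [gen_apply_ne_zero hne, h])
      simp only [hgγ, Finsupp.smul_apply, Finsupp.add_apply, Finsupp.sub_apply]
      rw [h0 _ _ (by simp [zact]), h0 _ _ (by simp [zact, ← octAct_dist]),
        h0 _ _ (by simp [zact, ← octAct_dist])]
      simp) hgsum hgmin
  let i₀ : Fin l := ⟨0, hl⟩
  let w₀ := octAct (octAct (octAct (u i₀) (a i₀)) (b i₀)) (c i₀)
  let Φ : Ch (Fin 6) (ℤ × Fin 6) →ₗ[ℤ] ZMod 3 := extend fun _ => tritL (phiCode (u i₀) w₀)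
  let Ψ : Ch (Fin 6) (ℤ × Fin 6) →ₗ[ℤ] ZMod 3 := extend fun _ => tritL (psiCode (u i₀) w₀)
  have hΦ s x y : Φ (gen s [x, y]) = trit (phiCode (u i₀) w₀) x y :=
    extend_gen_pair _ s (fun x => (trit_code_self _ _ x).1) x y
  have hΨ s x y : Ψ (gen s [x, y]) = trit (psiCode (u i₀) w₀) x y :=
    extend_gen_pair _ s (fun x => (trit_code_self _ _ x).2) x y
  have key i : evalCh etaL (proj (γ i)) = Φ (fmap (γ i)) + Ψ (gmap octAct (zact octAct) (γ i)) := by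
    rw [hfγ, hgγ, evalCh_proj, hγ, map_smul, extend_gen _ _ (chain_triple (hab i) (hbc i)),
      map_smul, map_smul, ← smul_add]
    simp only [map_add, map_sub, map_neg, hΦ, hΨ]
    congr 1
    exact eta_eq_coboundary (hab i) (hbc i) _ _ (by rw [hu i₀ i]; exact hw i i₀)
  calc
    evalCh etaL (proj (∑ i, γ i)) = ∑ i, evalCh etaL (proj (γ i)) := by
      simp only [evalCh_proj, map_sum]
    _ = Φ (∑ i, fmap (γ i)) + Ψ (∑ i, gmap octAct (zact octAct) (γ i)) := by
      simp only [key, Finset.sum_add_distrib, map_sum]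
    _ = 0 := by rw [hfsum, hgsum, map_zero, map_zero, add_zero]

end QHom
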